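/- Let q₀ : ℝ → ℝ be continuous with q₀(y) ≤ 0 for all y and q₀ = 0 outside a compact set. For each integer k ≥ 1 define Λ_k := sup{ ∫_{-1}^1 (-φ'(y)² - k²·q₀(k·y)·φ(y)²) dy : φ smooth, compactly supported in (-1,1), ∫_{-1}^1 φ² = 1 }, and define Λ_∞ := sup{ ∫_ℝ (-φ'(y)² - q₀(y)·φ(y)²) dy : φ smooth, compactly supported in ℝ, ∫_ℝ φ² = 1 }. Then Λ_k/k² → Λ_∞ as k → ∞. -/

import Mathlib

/-- The `L²`-normalized rescaling `y ↦ √c φ(c y)`. -/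
noncomputable def rescale (c : ℝ) (φ : ℝ → ℝ) (y : ℝ) : ℝ := √c * φ (c * y)

theorem contDiff_rescale {n : WithTop ℕ∞} (c : ℝ) {φ : ℝ → ℝ} (hφ : ContDiff ℝ n φ) :
    ContDiff ℝ n (rescale c φ) :=
  contDiff_const.mul (hφ.comp (contDiff_const.mul contDiff_id))

theorem deriv_rescale (c : ℝ) (φ : ℝ → ℝ) (y : ℝ) :
    deriv (rescale c φ) y = √c * (c * deriv φ (c * y)) := by
  change deriv (fun y => √c * φ (c * y)) y = _
  rw [deriv_const_mul_field, deriv_comp_mul_left, smul_eq_mul]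

theorem tsupport_rescale_subset (c : ℝ) (φ : ℝ → ℝ) :
    tsupport (rescale c φ) ⊆ (fun y => c * y) ⁻¹' tsupport φ :=
  (tsupport_mul_subset_right (f := fun _ : ℝ => √c) (g := φ ∘ fun y => c * y)).trans
    (tsupport_comp_subset_preimage φ (continuous_const_mul c))

theorem integral_const_mul_comp_mul_left {c : ℝ} (hc : 0 < c) (f : ℝ → ℝ) :
    ∫ y, c * f (c * y) = ∫ y, f y := by
  rw [MeasureTheory.integral_const_mul, MeasureTheory.Measure.integral_comp_mul_left, smul_eq_mul,
    abs_of_pos (inv_pos.2 hc), mul_inv_cancel_left₀ hc.ne']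

theorem integral_rescale_sq {c : ℝ} (hc : 0 < c) (φ : ℝ → ℝ) :
    ∫ y, rescale c φ y ^ 2 = ∫ y, φ y ^ 2 := by
  rw [← integral_const_mul_comp_mul_left hc (fun y => φ y ^ 2)]
  refine MeasureTheory.integral_congr_ae (.of_forall fun y => ?_)
  simp only [rescale, mul_pow, Real.sq_sqrt hc.le]

/-- The quadratic form `∫ (-φ'² - q φ²)` of the operator `φ'' - q φ`. -/
noncomputable def energy (q φ : ℝ → ℝ) : ℝ := ∫ y, (-(deriv φ y) ^ 2 - q y * φ y ^ 2)

theorem energy_rescale {c : ℝ} (hc : 0 < c) (q φ : ℝ → ℝ) :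
    energy (fun y => c ^ 2 * q (c * y)) (rescale c φ) = c ^ 2 * energy q φ := by
  rw [energy, energy,
    ← integral_const_mul_comp_mul_left hc (fun y => -(deriv φ y) ^ 2 - q y * φ y ^ 2),
    ← MeasureTheory.integral_const_mul]
  refine MeasureTheory.integral_congr_ae (.of_forall fun y => ?_)
  simp only [deriv_rescale, rescale, mul_pow, Real.sq_sqrt hc.le]
  ring

theorem intervalIntegral_eq_integral_of_eqOn_compl {f : ℝ → ℝ} {a b : ℝ} (hab : a ≤ b)
    (hf : ∀ y, y ∉ Set.Ioo a b → f y = 0) : ∫ y in a..b, f y = ∫ y, f y := by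
  rw [intervalIntegral.integral_of_le hab]
  exact MeasureTheory.setIntegral_eq_integral_of_forall_compl_eq_zero fun y hy =>
    hf y fun h => hy (Set.Ioo_subset_Ioc_self h)

theorem intervalIntegral_sq_eq_integral {φ : ℝ → ℝ} {a b : ℝ} (hab : a ≤ b)
    (hφ : tsupport φ ⊆ Set.Ioo a b) : ∫ y in a..b, φ y ^ 2 = ∫ y, φ y ^ 2 :=
  intervalIntegral_eq_integral_of_eqOn_compl hab fun y hy => by
    simp [image_eq_zero_of_notMem_tsupport fun h => hy (hφ h)]

theorem intervalIntegral_eq_energy {φ : ℝ → ℝ} {a b : ℝ} (hab : a ≤ b) (q : ℝ → ℝ)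
    (hφ : tsupport φ ⊆ Set.Ioo a b) :
    ∫ y in a..b, (-(deriv φ y) ^ 2 - q y * φ y ^ 2) = energy q φ :=
  intervalIntegral_eq_integral_of_eqOn_compl hab fun y hy => by
    simp [image_eq_zero_of_notMem_tsupport fun h => hy (hφ h),
      image_eq_zero_of_notMem_tsupport fun h => hy (hφ (tsupport_deriv_subset h))]

theorem energy_le {q φ : ℝ → ℝ} {M : ℝ} (hq : Continuous q) (hM : ∀ y, -q y ≤ M)
    (hφ : ContDiff ℝ 1 φ) (hφc : HasCompactSupport φ) : energy q φ ≤ M * ∫ y, φ y ^ 2 := by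
  have hd : Continuous (deriv φ) := hφ.continuous_deriv le_rfl
  have hφ0 : Continuous φ := hφ.continuous
  have zero_off : ∀ y, y ∉ tsupport φ → φ y = 0 ∧ deriv φ y = 0 := fun y hy =>
    ⟨image_eq_zero_of_notMem_tsupport hy,
      image_eq_zero_of_notMem_tsupport fun h => hy (tsupport_deriv_subset h)⟩
  rw [energy, ← MeasureTheory.integral_const_mul]
  refine MeasureTheory.integral_mono ?_ ?_ fun y => ?_
  · refine Continuous.integrable_of_hasCompactSupport (by fun_prop) ?_
    exact HasCompactSupport.intro hφc fun y hy => by simp [zero_off y hy]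
  · refine Continuous.integrable_of_hasCompactSupport (by fun_prop) ?_
    exact HasCompactSupport.intro hφc fun y hy => by simp [zero_off y hy]
  · have := mul_le_mul_of_nonneg_right (hM y) (sq_nonneg (φ y))
    have := sq_nonneg (deriv φ y)
    simp only
    linarith

theorem exists_contDiff_hasCompactSupport_integral_sq_eq_one :
    ∃ φ : ℝ → ℝ, ContDiff ℝ (⊤ : ℕ∞) φ ∧ HasCompactSupport φ ∧ ∫ y, φ y ^ 2 = 1 := by
  let f : ContDiffBump (0 : ℝ) := ⟨1, 2, one_pos, one_lt_two⟩
  have hpos : 0 < ∫ y, f y ^ 2 := by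
    refine Continuous.integral_pos_of_hasCompactSupport_nonneg_nonzero (x := 0)
      (f.continuous.pow 2) ?_ (fun y => sq_nonneg _) ?_
    · exact HasCompactSupport.intro f.hasCompactSupport fun y hy => by
        simp [image_eq_zero_of_notMem_tsupport hy]
    · have : f 0 = 1 := f.one_of_mem_closedBall (by simp [f])
      simp [this]
  refine ⟨fun y => (√(∫ y, f y ^ 2))⁻¹ * f y, contDiff_const.mul f.contDiff,
    f.hasCompactSupport.mul_left, ?_⟩
  simp only [mul_pow, inv_pow, Real.sq_sqrt hpos.le, MeasureTheory.integral_const_mul]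
  exact inv_mul_cancel₀ hpos.ne'

/-- Scaling limit of the variational eigenvalues: with
`Λ_k = sup { ∫_{-1}^1 (-φ'² - k² q₀(k·)φ²) : ∫_{-1}^1 φ² = 1, φ ∈ C_c^∞((-1,1)) }` and
`Λ_∞ = sup { ∫_ℝ (-φ'² - q₀ φ²) : ∫_ℝ φ² = 1, φ ∈ C_c^∞(ℝ) }`, one has
`Λ_k / k² → Λ_∞` as `k → ∞`. -/
theorem stmt14 (q₀ : ℝ → ℝ) (hq : Continuous q₀) (hq0 : ∀ y : ℝ, q₀ y ≤ 0)
    (hqsupp : HasCompactSupport q₀)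
    (Lam : ℕ → ℝ)
    (hLam : ∀ k : ℕ, 1 ≤ k → Lam k =
      sSup {v : ℝ | ∃ φ : ℝ → ℝ, ContDiff ℝ (⊤ : ℕ∞) φ ∧ tsupport φ ⊆ Set.Ioo (-1 : ℝ) 1 ∧
        (∫ y in (-1 : ℝ)..1, (φ y) ^ 2) = 1 ∧
        v = ∫ y in (-1 : ℝ)..1,
          (-(deriv φ y) ^ 2 - (k : ℝ) ^ 2 * q₀ ((k : ℝ) * y) * (φ y) ^ 2)})
    (LamInf : ℝ)
    (hLamInf : LamInf =
      sSup {v : ℝ | ∃ φ : ℝ → ℝ, ContDiff ℝ (⊤ : ℕ∞) φ ∧ HasCompactSupport φ ∧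
        (∫ y : ℝ, (φ y) ^ 2) = 1 ∧
        v = ∫ y : ℝ, (-(deriv φ y) ^ 2 - q₀ y * (φ y) ^ 2)}) :
    Filter.Tendsto (fun k : ℕ => Lam k / (k : ℝ) ^ 2) Filter.atTop (nhds LamInf) := by
  set T := {v : ℝ | ∃ φ : ℝ → ℝ, ContDiff ℝ (⊤ : ℕ∞) φ ∧ HasCompactSupport φ ∧
        (∫ y : ℝ, (φ y) ^ 2) = 1 ∧
        v = ∫ y : ℝ, (-(deriv φ y) ^ 2 - q₀ y * (φ y) ^ 2)} with hT
  set S : ℕ → Set ℝ := fun k =>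
    {v : ℝ | ∃ φ : ℝ → ℝ, ContDiff ℝ (⊤ : ℕ∞) φ ∧ tsupport φ ⊆ Set.Ioo (-1 : ℝ) 1 ∧
        (∫ y in (-1 : ℝ)..1, (φ y) ^ 2) = 1 ∧
        v = ∫ y in (-1 : ℝ)..1,
          (-(deriv φ y) ^ 2 - (k : ℝ) ^ 2 * q₀ ((k : ℝ) * y) * (φ y) ^ 2)} with hS
  have hT_ne : T.Nonempty := by
    obtain ⟨φ, h, hc, h1⟩ := exists_contDiff_hasCompactSupport_integral_sq_eq_one
    exact ⟨_, φ, h, hc, h1, rfl⟩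
  have hT_bdd : BddAbove T := by
    obtain ⟨M, hM⟩ := hqsupp.exists_bound_of_continuous hq
    refine ⟨M, ?_⟩
    rintro _ ⟨φ, h, hc, h1, rfl⟩
    have := energy_le hq (fun y => (neg_le_abs _).trans (hM y))
      (h.of_le (by exact_mod_cast le_top)) hc
    rwa [h1, mul_one] at this
  have hneg : (-1 : ℝ) ≤ 1 := by norm_num
  have hST : ∀ k : ℕ, 1 ≤ k → ∀ v ∈ S k, v / (k : ℝ) ^ 2 ∈ T := by
    rintro k hk _ ⟨φ, h, hsupp, h1, rfl⟩
    have hk0 : (0 : ℝ) < k := by exact_mod_cast hk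
    have hk' : (0 : ℝ) < (k : ℝ)⁻¹ := inv_pos.2 hk0
    refine ⟨rescale (k : ℝ)⁻¹ φ, contDiff_rescale _ h, ?_, ?_, ?_⟩
    · refine (isCompact_Icc (a := -(k : ℝ)) (b := k)).of_isClosed_subset
        (isClosed_tsupport _) fun y hy => ?_
      obtain ⟨h₁, h₂⟩ := hsupp (tsupport_rescale_subset _ _ hy)
      have hy' : y = k * ((k : ℝ)⁻¹ * y) := (mul_inv_cancel_left₀ hk0.ne' y).symm
      constructor <;> nlinarith
    · rw [integral_rescale_sq hk', ← intervalIntegral_sq_eq_integral hneg hsupp, h1]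
    · rw [intervalIntegral_eq_energy hneg (fun y => (k : ℝ) ^ 2 * q₀ (k * y)) hsupp,
        div_eq_inv_mul, ← inv_pow, ← energy_rescale hk', energy]
      refine MeasureTheory.integral_congr_ae (.of_forall fun y => ?_)
      simp only [mul_inv_cancel_left₀ hk0.ne', inv_pow, inv_mul_cancel_left₀ (pow_ne_zero 2 hk0.ne')]
  have hTS : ∀ w ∈ T, ∀ᶠ k : ℕ in Filter.atTop, (k : ℝ) ^ 2 * w ∈ S k := by
    rintro _ ⟨φ, h, hc, h1, rfl⟩
    obtain ⟨R, hR⟩ := hc.isBounded.subset_ball (0 : ℝ)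
    filter_upwards [Filter.eventually_ge_atTop 1,
      tendsto_natCast_atTop_atTop.eventually_ge_atTop R] with k hk hkR
    have hk0 : (0 : ℝ) < k := by exact_mod_cast hk
    have hsupp : tsupport (rescale k φ) ⊆ Set.Ioo (-1 : ℝ) 1 := fun y hy => by
      have hy' := hR (tsupport_rescale_subset _ _ hy)
      rw [mem_ball_zero_iff, Real.norm_eq_abs, abs_lt] at hy'
      constructor <;> nlinarith
    refine ⟨rescale k φ, contDiff_rescale _ h, hsupp, ?_, ?_⟩
    · rw [intervalIntegral_sq_eq_integral hneg hsupp, integral_rescale_sq hk0, h1]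
    · rw [intervalIntegral_eq_energy hneg (fun y => (k : ℝ) ^ 2 * q₀ (k * y)) hsupp,
        energy_rescale hk0, energy]
  have hS_le : ∀ k : ℕ, 1 ≤ k → ∀ v ∈ S k, v ≤ LamInf * (k : ℝ) ^ 2 := fun k hk v hv => by
    have hk0 : (0 : ℝ) < k := by exact_mod_cast hk
    rw [← div_le_iff₀ (by positivity), hLamInf]
    exact le_csSup hT_bdd (hST k hk v hv)
  refine tendsto_order.2 ⟨fun a ha => ?_, fun a ha => ?_⟩
  · obtain ⟨w, hw, haw⟩ := exists_lt_of_lt_csSup hT_ne (hLamInf ▸ ha)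
    filter_upwards [hTS w hw, Filter.eventually_ge_atTop 1] with k hkw hk
    have hk0 : (0 : ℝ) < k := by exact_mod_cast hk
    refine haw.trans_le ?_
    rw [le_div_iff₀ (by positivity), mul_comm, hLam k hk]
    exact le_csSup ⟨_, hS_le k hk⟩ hkw
  · obtain ⟨w, hw⟩ := hT_ne
    filter_upwards [hTS w hw, Filter.eventually_ge_atTop 1] with k hkw hk
    have hk0 : (0 : ℝ) < k := by exact_mod_cast hk
    refine lt_of_le_of_lt ?_ ha
    rw [div_le_iff₀ (by positivity), hLam k hk]
    exact csSup_le ⟨_, hkw⟩ (hS_le k hk)
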